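/- arXiv:1404.1516 — 3 statements merged into one kernel-verified Lean document; each statement's English description precedes it below -/
import Mathlib

section
/- Let n ∈ ℕ with √d·2^{-n} < T and let S : [0,T] → (0,∞)^d be càdlàg, continuous at t = T, with S(0) = (1,…,1). With τ_0,…,τ_M the exit times of step √d·2^{-n}, τ̂_0,…,τ̂_{M+1} the associated deterministic-grid times, and π^{(m)} the dyadic rounding maps, define the piecewise-constant paths Π(S)_t := Σ_{k=0}^{M−2} S_{τ_k}·1_{[τ_k,τ_{k+1})}(t) + S_{τ_{M−1}}·1_{[τ_{M−1},T]}(t), Π̌(S)_t := Σ_{k=0}^{M−2} π^{(n+k)}(S_{τ_k})·1_{[τ_k,τ_{k+1})}(t) + π^{(n)}(S_{τ_{M−1}})·1_{[τ_{M−1},T]}(t), and Π̂(S)_t := Σ_{k=0}^{M−1} π^{(n+k)}(S_{τ_k})·1_{[τ̂_k,τ̂_{k+1})}(t) + π^{(n)}(S_T)·1_{[τ̂_M,T]}(t). Then, in the Skorokhod distance, d(S, Π(S)) ≤ √d·2^{-n}, d(Π(S), Π̌(S)) ≤ √d·2^{-n}, and d(Π̌(S), Π̂(S)) ≤ 3√d·2^{-n}.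 -/
open Filter Set
open scoped Classical

noncomputable section

/-- `ℝ^d` with the Euclidean norm. -/
abbrev E (d : ℕ) : Type := EuclideanSpace ℝ (Fin d)

/-- `f` is càdlàg on `[0,T]`: right-continuous on `[0,T)` and with left limits on `(0,T]`. -/
def IsCadlagOn (d : ℕ) (T : ℝ) (f : ℝ → E d) : Prop :=
  (∀ t ∈ Set.Ico (0:ℝ) T, Tendsto f (nhdsWithin t (Set.Ioo t T)) (nhds (f t))) ∧
  (∀ t ∈ Set.Ioc (0:ℝ) T, ∃ L, Tendsto f (nhdsWithin t (Set.Ico 0 t)) (nhds L))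

/-- `f` is (left-)continuous at maturity `t = T`. -/
def ContinuousAtMaturity (d : ℕ) (T : ℝ) (f : ℝ → E d) : Prop :=
  Tendsto f (nhdsWithin T (Set.Ico 0 T)) (nhds (f T))

/-- The Skorokhod distance on paths. -/
def skorokhodDist (d : ℕ) (T : ℝ) (ω ωt : ℝ → E d) : ℝ :=
  sInf {r : ℝ | ∃ lam : ℝ → ℝ, StrictMonoOn lam (Set.Icc 0 T) ∧
    Set.BijOn lam (Set.Icc 0 T) (Set.Icc 0 T) ∧
    ∀ t ∈ Set.Icc (0:ℝ) T, ‖ω t - ωt (lam t)‖ + |lam t - t| ≤ r}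

/-- The exit times of step `δ`. -/
def exitTimes (d : ℕ) (T δ : ℝ) (f : ℝ → E d) : ℕ → ℝ
  | 0 => 0
  | k + 1 =>
      let τk := exitTimes d T δ f k
      let S : Set ℝ := {t : ℝ | τk < t ∧ δ ≤ ‖f t - f τk‖}
      if S.Nonempty then min T (min (τk + δ) (sInf S)) else min T (τk + δ)

/-- `M = min{k : τ_k = T}`. -/
def exitCount (d : ℕ) (T δ : ℝ) (f : ℝ → E d) : ℕ :=
  sInf {k : ℕ | exitTimes d T δ f k = T}

/-- The dyadic grid set `B^{(i)}`. -/
def Bset (d i : ℕ) : Set ℝ :=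
  {x | ∃ k : ℕ, 0 < k ∧ x = (k : ℝ) * (Real.sqrt d * 2 ^ (-(i : ℤ)))} ∪
  {x | ∃ k : ℕ, 0 < k ∧ x = Real.sqrt d * 2 ^ (-(i : ℤ)) / (k : ℝ)}

/-- The deterministic grid times `τ̂_k`. -/
def gridTimes (d n : ℕ) (T : ℝ) (τ : ℕ → ℝ) (M : ℕ) : ℕ → ℝ
  | 0 => 0
  | 1 => Real.sqrt d * 2 ^ (-(n : ℤ))
  | k + 2 =>
      if k + 2 ≤ M then
        gridTimes d n T τ M (k + 1) +
          (1 - Real.sqrt d * 2 ^ (-(n : ℤ)) / T) *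
            sSup {s : ℝ | s ∈ Bset d (n + (k + 2)) ∧ s < τ (k + 1) - τ k}
      else T

/-- The dyadic rounding map `π^{(m)}(x)_i = 2^{-m}·⌈2^m x_i⌉`. -/
def dyadicRound (d m : ℕ) (x : E d) : E d :=
  WithLp.toLp 2 fun i => (2 : ℝ) ^ (-(m : ℤ)) * ((⌈(2 : ℝ) ^ (m : ℤ) * x i⌉ : ℤ) : ℝ)

/-- `Π(S)_t = Σ_{k=0}^{M−2} S_{τ_k} 1_{[τ_k,τ_{k+1})}(t) + S_{τ_{M−1}} 1_{[τ_{M−1},T]}(t)`. -/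
def piPlain (d n : ℕ) (T : ℝ) (S : ℝ → E d) : ℝ → E d :=
  let δ := Real.sqrt d * 2 ^ (-(n : ℤ))
  let τ := exitTimes d T δ S
  let M := exitCount d T δ S
  fun t =>
    (∑ k ∈ Finset.range (M - 1),
      Set.indicator (Set.Ico (τ k) (τ (k + 1))) (fun _ => S (τ k)) t)
    + Set.indicator (Set.Icc (τ (M - 1)) T) (fun _ => S (τ (M - 1))) t

/-- `Π̌(S)_t = Σ_{k=0}^{M−2} π^{(n+k)}(S_{τ_k}) 1_{[τ_k,τ_{k+1})}(t)
              + π^{(n)}(S_{τ_{M−1}}) 1_{[τ_{M−1},T]}(t)`. -/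
def piCheck (d n : ℕ) (T : ℝ) (S : ℝ → E d) : ℝ → E d :=
  let δ := Real.sqrt d * 2 ^ (-(n : ℤ))
  let τ := exitTimes d T δ S
  let M := exitCount d T δ S
  fun t =>
    (∑ k ∈ Finset.range (M - 1),
      Set.indicator (Set.Ico (τ k) (τ (k + 1))) (fun _ => dyadicRound d (n + k) (S (τ k))) t)
    + Set.indicator (Set.Icc (τ (M - 1)) T) (fun _ => dyadicRound d n (S (τ (M - 1)))) t

/-- `Π̂(S)_t = Σ_{k=0}^{M−1} π^{(n+k)}(S_{τ_k}) 1_{[τ̂_k,τ̂_{k+1})}(t)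
              + π^{(n)}(S_T) 1_{[τ̂_M,T]}(t)`. -/
def hatPi (d n : ℕ) (T : ℝ) (S : ℝ → E d) : ℝ → E d :=
  let δ := Real.sqrt d * 2 ^ (-(n : ℤ))
  let τ := exitTimes d T δ S
  let M := exitCount d T δ S
  let τh := gridTimes d n T τ M
  fun t =>
    (∑ k ∈ Finset.range M,
      Set.indicator (Set.Ico (τh k) (τh (k + 1))) (fun _ => dyadicRound d (n + k) (S (τ k))) t)
    + Set.indicator (Set.Icc (τh M) T) (fun _ => dyadicRound d n (S T)) t

lemma skd_le {d : ℕ} {T : ℝ} (hT : 0 < T) {ω ωt : ℝ → E d} {r : ℝ} (lam : ℝ → ℝ)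
    (h1 : StrictMonoOn lam (Set.Icc 0 T)) (h2 : Set.BijOn lam (Set.Icc 0 T) (Set.Icc 0 T))
    (h3 : ∀ t ∈ Set.Icc (0:ℝ) T, ‖ω t - ωt (lam t)‖ + |lam t - t| ≤ r) :
    skorokhodDist d T ω ωt ≤ r := by
  unfold skorokhodDist
  apply csInf_le
  · refine ⟨0, ?_⟩
    rintro r' ⟨l, _, _, h⟩
    have := h 0 ⟨le_rfl, hT.le⟩
    have h0 := norm_nonneg (ω 0 - ωt (l 0))
    have h0' := abs_nonneg (l 0 - 0)
    linarith
  · exact ⟨lam, h1, h2, h3⟩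

lemma skd_le_id {d : ℕ} {T : ℝ} (hT : 0 < T) {ω ωt : ℝ → E d} {r : ℝ}
    (h3 : ∀ t ∈ Set.Icc (0:ℝ) T, ‖ω t - ωt t‖ ≤ r) :
    skorokhodDist d T ω ωt ≤ r := by
  apply skd_le hT id (strictMono_id.strictMonoOn _) (Set.bijOn_id _)
  intro t ht
  simpa using h3 t ht

lemma exit_step {d : ℕ} {T δ : ℝ} (hδ : 0 < δ) {f : ℝ → E d} (hf : IsCadlagOn d T f) (k : ℕ)
    (h0 : 0 ≤ exitTimes d T δ f k) (hk : exitTimes d T δ f k < T) :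
    exitTimes d T δ f k < exitTimes d T δ f (k+1) ∧ exitTimes d T δ f (k+1) ≤ T ∧
    exitTimes d T δ f (k+1) ≤ exitTimes d T δ f k + δ ∧
    (∀ t, exitTimes d T δ f k < t → t < exitTimes d T δ f (k+1) →
      ‖f t - f (exitTimes d T δ f k)‖ < δ) ∧
    (exitTimes d T δ f (k+1) = T ∨ exitTimes d T δ f (k+1) = exitTimes d T δ f k + δ ∨
      ∀ b, exitTimes d T δ f (k+1) < b →
        ∃ t, exitTimes d T δ f k < t ∧ t < b ∧ δ ≤ ‖f t - f (exitTimes d T δ f k)‖) := by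
  have e : exitTimes d T δ f (k+1) =
      if {t : ℝ | exitTimes d T δ f k < t ∧ δ ≤ ‖f t - f (exitTimes d T δ f k)‖}.Nonempty
      then min T (min (exitTimes d T δ f k + δ)
        (sInf {t : ℝ | exitTimes d T δ f k < t ∧ δ ≤ ‖f t - f (exitTimes d T δ f k)‖}))
      else min T (exitTimes d T δ f k + δ) := by
    rw [exitTimes]
  generalize exitTimes d T δ f (k+1) = τ' at *
  generalize exitTimes d T δ f k = τ at *
  set A : Set ℝ := {t : ℝ | τ < t ∧ δ ≤ ‖f t - f τ‖} with hA
  have hbdd : BddBelow A := ⟨τ, fun t ht => ht.1.le⟩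
  by_cases hne : A.Nonempty
  · rw [if_pos hne] at e
    have hlt : τ < sInf A := by
      have h := hf.1 τ ⟨h0, hk⟩
      have h' := h (Metric.ball_mem_nhds (f τ) hδ)
      rw [nhdsWithin_Ioo_eq_nhdsGT hk] at h'
      obtain ⟨u, hu, hsub⟩ := mem_nhdsGT_iff_exists_Ioo_subset.1 h'
      have : u ≤ sInf A := by
        apply le_csInf hne
        intro t ht
        by_contra hlt
        push Not at hlt
        have := hsub ⟨ht.1, hlt⟩
        simp only [mem_preimage, Metric.mem_ball, dist_eq_norm] at this
        exact absurd ht.2 (not_le.2 this)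
      exact lt_of_lt_of_le hu this
    refine ⟨?_, ?_, ?_, ?_, ?_⟩
    · rw [e]; exact lt_min hk (lt_min (by linarith) hlt)
    · rw [e]; exact min_le_left _ _
    · rw [e]; exact (min_le_right _ _).trans (min_le_left _ _)
    · intro t ht ht'
      by_contra hc
      push Not at hc
      have h1 : sInf A ≤ t := csInf_le hbdd ⟨ht, hc⟩
      have h2 : τ' ≤ sInf A := by rw [e]; exact (min_le_right _ _).trans (min_le_right _ _)
      linarith
    · rcases min_choice T (min (τ + δ) (sInf A)) with h | h
      · left; rw [e, h]
      · right
        rcases min_choice (τ + δ) (sInf A) with h' | h'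
        · left; rw [e, h, h']
        · right
          intro b hb
          rw [e, h, h'] at hb
          obtain ⟨t, ht, htb⟩ := exists_lt_of_csInf_lt hne hb
          exact ⟨t, ht.1, htb, ht.2⟩
  · rw [if_neg hne] at e
    refine ⟨?_, ?_, ?_, ?_, ?_⟩
    · rw [e]; exact lt_min hk (by linarith)
    · rw [e]; exact min_le_left _ _
    · rw [e]; exact min_le_right _ _
    · intro t ht ht'
      by_contra hc
      push Not at hc
      exact hne ⟨t, ht, hc⟩
    · rcases min_choice T (τ + δ) with h | h
      · left; rw [e, h]
      · right; left; rw [e, h]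

lemma exit_finite {d : ℕ} {T δ : ℝ} (hT : 0 < T) (hδ : 0 < δ) {f : ℝ → E d}
    (hf : IsCadlagOn d T f) : ∃ k, exitTimes d T δ f k = T := by
  by_contra hc
  push Not at hc
  have hb : ∀ k, 0 ≤ exitTimes d T δ f k ∧ exitTimes d T δ f k < T := by
    intro k
    induction k with
    | zero => simp [exitTimes, hT]
    | succ k ih =>
      obtain ⟨h1, h2, _⟩ := exit_step hδ hf k ih.1 ih.2
      exact ⟨ih.1.trans h1.le, lt_of_le_of_ne h2 (hc _)⟩
  have hstep := fun k => exit_step hδ hf k (hb k).1 (hb k).2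
  set τ := exitTimes d T δ f with hτ
  have hmono : StrictMono τ := strictMono_nat_of_lt_succ (fun k => (hstep k).1)
  have hbdd : BddAbove (Set.range τ) := ⟨T, by rintro _ ⟨k, rfl⟩; exact (hb k).2.le⟩
  have hlim := tendsto_atTop_ciSup hmono.monotone hbdd
  set L := ⨆ k, τ k with hL
  have hlt : ∀ k, τ k < L := fun k => lt_of_lt_of_le (hmono (Nat.lt_succ_self k)) (le_ciSup hbdd (k+1))
  have hLT : L ≤ T := ciSup_le (fun k => (hb k).2.le)
  have hL0 : 0 < L := lt_of_le_of_lt (hb 0).1 (hlt 0)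
  obtain ⟨l, hl⟩ := hf.2 L ⟨hL0, hLT⟩
  rw [nhdsWithin_Ico_eq_nhdsLT hL0] at hl
  have h' := hl (Metric.ball_mem_nhds l (half_pos hδ))
  obtain ⟨u, hu, hsub⟩ := mem_nhdsLT_iff_exists_Ioo_subset.1 h'
  have ev : ∀ᶠ k in atTop, max u (L - δ) < τ k :=
    hlim.eventually (lt_mem_nhds (max_lt hu (by linarith)))
  obtain ⟨k, hk⟩ := ev.exists
  have hku := lt_of_le_of_lt (le_max_left _ _) hk
  have hkd := lt_of_le_of_lt (le_max_right _ _) hk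
  rcases (hstep k).2.2.2.2 with h | h | h
  · exact hc _ h
  · have := hlt (k+1); linarith
  · obtain ⟨t, ht1, ht2, ht3⟩ := h L (hlt _)
    have a1 := hsub ⟨hku, hlt k⟩
    have a2 := hsub ⟨hku.trans ht1, ht2⟩
    simp only [mem_preimage, Metric.mem_ball] at a1 a2
    have := dist_triangle_right (f t) (f (τ k)) l
    rw [dist_eq_norm (f t)] at this
    linarith

lemma sum_step {d : ℕ} (a : ℕ → ℝ) (v : ℕ → E d) (K : ℕ) (ha : ∀ k < K, a k < a (k+1))
    (t : ℝ) (j : ℕ) (hj : j < K) (ht : t ∈ Set.Ico (a j) (a (j+1))) :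
    ∑ k ∈ Finset.range K, Set.indicator (Set.Ico (a k) (a (k + 1))) (fun _ => v k) t = v j := by
  have hm : ∀ q ≤ K, ∀ p ≤ q, a p ≤ a q := by
    intro q hq p hp
    induction q, hp using Nat.le_induction with
    | base => exact le_rfl
    | succ q hpq ih => exact (ih (by omega)).trans (ha q (by omega)).le
  rw [Finset.sum_eq_single j]
  · rw [Set.indicator_of_mem ht]
  · intro b hb hbj
    have hb := Finset.mem_range.1 hb
    apply Set.indicator_of_notMem
    rintro ⟨h1, h2⟩
    rcases lt_or_gt_of_ne hbj with h | h
    · have := hm j hj.le (b+1) h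
      linarith [ht.1]
    · have := hm b hb.le (j+1) h
      linarith [ht.2]
  · intro h; exact absurd (Finset.mem_range.2 hj) h

lemma sum_step_zero {d : ℕ} (a : ℕ → ℝ) (v : ℕ → E d) (K : ℕ) (ha : ∀ k < K, a k < a (k+1))
    (t : ℝ) (ht : a K ≤ t) :
    ∑ k ∈ Finset.range K, Set.indicator (Set.Ico (a k) (a (k + 1))) (fun _ => v k) t = 0 := by
  have hm : ∀ q ≤ K, ∀ p ≤ q, a p ≤ a q := by
    intro q hq p hp
    induction q, hp using Nat.le_induction with
    | base => exact le_rfl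
    | succ q hpq ih => exact (ih (by omega)).trans (ha q (by omega)).le
  apply Finset.sum_eq_zero
  intro b hb
  have hb := Finset.mem_range.1 hb
  apply Set.indicator_of_notMem
  rintro ⟨h1, h2⟩
  have := hm K le_rfl (b+1) hb
  linarith

/-- Locate a point in a partition. -/
lemma locate (a : ℕ → ℝ) (K : ℕ) (t : ℝ) (h0 : a 0 ≤ t) (hK : t < a K) :
    ∃ j < K, t ∈ Set.Ico (a j) (a (j+1)) := by
  induction K with
  | zero => linarith
  | succ K ih =>
    by_cases h : t < a K
    · obtain ⟨j, hj, hh⟩ := ih h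
      exact ⟨j, by omega, hh⟩
    · exact ⟨K, by omega, not_lt.1 h, hK⟩

lemma pw_linear (x y : ℕ → ℝ) (N : ℕ) (hx : ∀ k < N, x k < x (k+1)) (hy : ∀ k < N, y k < y (k+1)) :
    ∃ lam : ℝ → ℝ, StrictMono lam ∧ Function.Surjective lam ∧ (∀ k ≤ N, lam (x k) = y k) ∧
      ∀ k < N, ∀ t ∈ Set.Icc (x k) (x (k+1)), ∀ B, |y k - x k| ≤ B →
        |y (k+1) - x (k+1)| ≤ B → |lam t - t| ≤ B := by
  induction N with
  | zero =>
    refine ⟨fun t => t - x 0 + y 0, fun a b h => by dsimp only; linarith,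
      fun z => ⟨z - y 0 + x 0, by ring⟩, ?_, ?_⟩
    · intro k hk
      obtain rfl : k = 0 := by omega
      ring
    · intro k hk; omega
  | succ N ih =>
    obtain ⟨lam, hm, hs, hn, hb⟩ := ih (fun k hk => hx k (by omega)) (fun k hk => hy k (by omega))
    have hxN := hx N (by omega)
    have hyN := hy N (by omega)
    have hlN := hn N le_rfl
    have hxm : ∀ k ≤ N, x k ≤ x N := by
      intro k hk
      induction hk using Nat.decreasingInduction with
      | self => exact le_rfl
      | of_succ k hk ih => exact (hx k (by omega)).le.trans ih
    set c := (y (N+1) - y N) / (x (N+1) - x N) with hc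
    have hc0 : 0 < c := div_pos (by linarith) (by linarith)
    have hcm : c * (x (N+1) - x N) = y (N+1) - y N := by
      rw [hc]; field_simp [(by linarith : x (N+1) - x N ≠ 0)]
    refine ⟨fun t => if t ≤ x N then lam t else y N + c * (t - x N), ?_, ?_, ?_, ?_⟩
    · intro a b hab
      dsimp only
      split_ifs with h1 h2 h2
      · exact hm hab
      · have : lam a ≤ lam (x N) := hm.monotone h1
        have : 0 < c * (b - x N) := mul_pos hc0 (by linarith)
        linarith
      · linarith
      · have : c * (a - x N) < c * (b - x N) := mul_lt_mul_of_pos_left (by linarith) hc0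
        linarith
    · intro z
      by_cases hz : z ≤ y N
      · obtain ⟨t, ht⟩ := hs z
        refine ⟨t, ?_⟩
        have : t ≤ x N := by
          rw [← hm.le_iff_le, ht, hlN]; exact hz
        simp [this, ht]
      · push Not at hz
        refine ⟨x N + (z - y N) / c, ?_⟩
        have : 0 < (z - y N) / c := div_pos (by linarith) hc0
        have h2 : ¬ (x N + (z - y N) / c ≤ x N) := by linarith
        dsimp only
        rw [if_neg h2]
        field_simp
        ring
    · intro k hk
      dsimp only
      rcases Nat.lt_or_ge N k with h | h
      · obtain rfl : k = N + 1 := by omega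
        rw [if_neg (by linarith)]
        linarith
      · rw [if_pos (hxm k h)]
        exact hn k h
    · intro k hk t ht B h1 h2
      dsimp only
      rcases Nat.lt_or_ge k N with h | h
      · rw [if_pos (ht.2.trans (hxm (k+1) h))]
        exact hb k h t ht B h1 h2
      · obtain rfl : k = N := by omega
        have key : (if t ≤ x k then lam t else y k + c * (t - x k)) = y k + c * (t - x k) := by
          split_ifs with h'
          · have : t = x k := le_antisymm h' ht.1
            rw [this, hlN]; ring
          · rfl
        rw [key]
        set θ := (t - x k) / (x (k+1) - x k) with hθ
        have hpos : 0 < x (k+1) - x k := by linarith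
        have t0 : 0 ≤ θ := div_nonneg (by linarith [ht.1]) hpos.le
        have t1 : θ ≤ 1 := by rw [hθ, div_le_one hpos]; linarith [ht.2]
        have tt : t - x k = θ * (x (k+1) - x k) := by rw [hθ]; field_simp
        have e : y k + c * (t - x k) - t = (1 - θ) * (y k - x k) + θ * (y (k+1) - x (k+1)) := by
          have : c * (t - x k) = θ * (y (k+1) - y k) := by rw [tt, ← hcm]; ring
          linear_combination this - tt
        rw [e]
        rw [abs_le] at h1 h2 ⊢
        constructor <;> nlinarith [h1.1, h1.2, h2.1, h2.2]

lemma grid_sup (d i : ℕ) (hd : 1 ≤ d) (x : ℝ) (hx : 0 < x) :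
    0 < sSup {s : ℝ | s ∈ Bset d i ∧ s < x} ∧ sSup {s : ℝ | s ∈ Bset d i ∧ s < x} ≤ x ∧
    x - Real.sqrt d * 2 ^ (-(i : ℤ)) ≤ sSup {s : ℝ | s ∈ Bset d i ∧ s < x} := by
  have he : 0 < Real.sqrt d * 2 ^ (-(i : ℤ)) := by
    have : 0 < Real.sqrt d := Real.sqrt_pos.2 (by exact_mod_cast hd)
    positivity
  unfold Bset
  set e := Real.sqrt d * 2 ^ (-(i : ℤ)) with hee
  set A := {s : ℝ | s ∈ {x | ∃ k : ℕ, 0 < k ∧ x = (k : ℝ) * e} ∪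
    {x | ∃ k : ℕ, 0 < k ∧ x = e / (k : ℝ)} ∧ s < x} with hA
  have hbdd : BddAbove A := ⟨x, fun s hs => hs.2.le⟩
  obtain ⟨k, hk⟩ := exists_nat_gt (e / x)
  have hk0 : (0:ℝ) < k := lt_trans (div_pos he hx) hk
  have hmem : e / k ∈ A := ⟨Or.inr ⟨k, by exact_mod_cast hk0, rfl⟩, by
    rw [div_lt_iff₀ hk0]; rw [div_lt_iff₀ hx] at hk; linarith⟩
  have hpos : 0 < sSup A := lt_of_lt_of_le (div_pos he hk0) (le_csSup hbdd hmem)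
  refine ⟨hpos, csSup_le ⟨_, hmem⟩ (fun s hs => hs.2.le), ?_⟩
  by_cases hxe : x ≤ e
  · linarith
  · push Not at hxe
    have h1 : 1 < x / e := by rwa [one_lt_div he]
    have c1 := Nat.ceil_lt_add_one (a := x / e) (by linarith)
    have c2 := Nat.le_ceil (x / e)
    have c3 : 1 < ⌈x / e⌉₊ := by
      have : (1:ℝ) < ⌈x / e⌉₊ := by linarith
      exact_mod_cast this
    obtain ⟨m, hm⟩ : ∃ m, ⌈x / e⌉₊ = m + 1 := ⟨⌈x / e⌉₊ - 1, by omega⟩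
    rw [hm] at c1 c2 c3
    push_cast at c1 c2
    have c1' : (m:ℝ) * e < x := by
      rw [← lt_div_iff₀ he]; linarith
    have c2' : x ≤ (m + 1) * e := by
      rwa [div_le_iff₀ he] at c2
    have : (m:ℝ) * e ≤ sSup A := le_csSup hbdd ⟨Or.inl ⟨m, by omega, rfl⟩, c1'⟩
    linarith

lemma norm_le_coord {d : ℕ} (z : E d) (c : ℝ) (hc : 0 ≤ c) (h : ∀ i, |z i| ≤ c) :
    ‖z‖ ≤ Real.sqrt d * c := by
  rw [EuclideanSpace.norm_eq]
  have : ∑ i, ‖z i‖ ^ 2 ≤ d * c ^ 2 := by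
    calc ∑ i, ‖z i‖ ^ 2 ≤ ∑ i : Fin d, c ^ 2 := by
          apply Finset.sum_le_sum
          intro i _
          rw [Real.norm_eq_abs]
          exact pow_le_pow_left₀ (abs_nonneg _) (h i) 2
      _ = d * c ^ 2 := by simp
  calc Real.sqrt (∑ i, ‖z i‖ ^ 2) ≤ Real.sqrt (d * c ^ 2) := Real.sqrt_le_sqrt this
    _ = Real.sqrt d * c := by
      rw [Real.sqrt_mul (by positivity), Real.sqrt_sq hc]

lemma round_coord (d n m : ℕ) (hm : n ≤ m) (z : E d) (i : Fin d) :
    0 ≤ dyadicRound d m z i - z i ∧ dyadicRound d m z i - z i ≤ 2 ^ (-(n : ℤ)) := by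
  have h2 : (2:ℝ) ^ (-(m:ℤ)) * 2 ^ (m:ℤ) = 1 := by
    rw [← zpow_add₀ (by norm_num)]; simp
  have hp : (0:ℝ) < 2 ^ (-(m:ℤ)) := by positivity
  have hle : (2:ℝ) ^ (-(m:ℤ)) ≤ 2 ^ (-(n:ℤ)) := zpow_le_zpow_right₀ (by norm_num) (by omega)
  have a1 := Int.le_ceil ((2:ℝ) ^ (m:ℤ) * z i)
  have a2 := Int.ceil_lt_add_one ((2:ℝ) ^ (m:ℤ) * z i)
  have e : dyadicRound d m z i = (2 : ℝ) ^ (-(m : ℤ)) * ((⌈(2 : ℝ) ^ (m : ℤ) * z i⌉ : ℤ) : ℝ) := rfl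
  rw [e]
  have b1 := mul_le_mul_of_nonneg_left a1 hp.le
  have b2 := mul_le_mul_of_nonneg_left a2.le hp.le
  rw [← mul_assoc, h2] at b1
  rw [mul_add, ← mul_assoc, h2] at b2
  constructor <;> linarith

lemma round_sub (d n m : ℕ) (hm : n ≤ m) (z : E d) :
    ‖z - dyadicRound d m z‖ ≤ Real.sqrt d * 2 ^ (-(n : ℤ)) := by
  apply norm_le_coord _ _ (by positivity)
  intro i
  have := round_coord d n m hm z i
  rw [PiLp.sub_apply, abs_le]
  constructor <;> linarith

lemma round_diff (d n m m' : ℕ) (hm : n ≤ m) (hm' : n ≤ m') (z w : E d) :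
    ‖dyadicRound d m z - dyadicRound d m' w‖ ≤ ‖z - w‖ + Real.sqrt d * 2 ^ (-(n : ℤ)) := by
  have h : ‖(dyadicRound d m z - z) - (dyadicRound d m' w - w)‖ ≤ Real.sqrt d * 2 ^ (-(n : ℤ)) := by
    apply norm_le_coord _ _ (by positivity)
    intro i
    have h1 := round_coord d n m hm z i
    have h2 := round_coord d n m' hm' w i
    simp only [PiLp.sub_apply]
    rw [abs_le]
    constructor <;> linarith
  have e : dyadicRound d m z - dyadicRound d m' w =
    (z - w) + ((dyadicRound d m z - z) - (dyadicRound d m' w - w)) := by abel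
  rw [e]
  exact (norm_add_le _ _).trans (by linarith)

lemma grid_bounds (d n : ℕ) (hd : 1 ≤ d) (T : ℝ) (hδT : Real.sqrt d * 2 ^ (-(n : ℤ)) < T)
    (τ : ℕ → ℝ) (M : ℕ) (h0 : τ 0 = 0) (hτ : ∀ k < M, τ k < τ (k+1)) (k : ℕ) (hk : k + 1 ≤ M) :
    gridTimes d n T τ M k < gridTimes d n T τ M (k+1) ∧
    gridTimes d n T τ M (k+1) ≤ Real.sqrt d * 2 ^ (-(n : ℤ)) +
      (1 - Real.sqrt d * 2 ^ (-(n : ℤ)) / T) * τ k ∧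
    Real.sqrt d * 2 ^ (-(n : ℤ)) + (1 - Real.sqrt d * 2 ^ (-(n : ℤ)) / T) *
      (τ k - (Real.sqrt d * 2 ^ (-(n : ℤ))) * (1/2 - (1/2)^(k+1))) ≤ gridTimes d n T τ M (k+1) := by
  have he : 0 < Real.sqrt d * 2 ^ (-(n : ℤ)) := by
    have : 0 < Real.sqrt d := Real.sqrt_pos.2 (by exact_mod_cast hd)
    positivity
  have hc : 0 < 1 - Real.sqrt d * 2 ^ (-(n : ℤ)) / T := by
    have := (div_lt_one (he.trans hδT)).2 hδT
    linarith
  induction k with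
  | zero => simp [gridTimes, h0]; linarith
  | succ k ih =>
    obtain ⟨_, i2, i3⟩ := ih (by omega)
    have e : gridTimes d n T τ M (k+1+1) = gridTimes d n T τ M (k + 1) +
          (1 - Real.sqrt d * 2 ^ (-(n : ℤ)) / T) *
            sSup {s : ℝ | s ∈ Bset d (n + (k + 2)) ∧ s < τ (k + 1) - τ k} := by
      rw [gridTimes, if_pos (by omega)]
    obtain ⟨g1, g2, g3⟩ := grid_sup d (n + (k+2)) hd (τ (k+1) - τ k)
      (by linarith [hτ k (by omega)])
    have ee : Real.sqrt d * 2 ^ (-((n + (k+2) : ℕ) : ℤ)) =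
        Real.sqrt d * 2 ^ (-(n : ℤ)) * (1/2)^(k+2) := by
      rw [mul_assoc]; congr 1
      push_cast
      rw [neg_add, zpow_add₀ (by norm_num), zpow_neg 2 ((k:ℤ)+2), one_div, inv_pow]
      norm_cast
    rw [ee] at g3
    rw [e]
    set s := sSup {s : ℝ | s ∈ Bset d (n + (k + 2)) ∧ s < τ (k + 1) - τ k}
    set δ := Real.sqrt d * 2 ^ (-(n : ℤ))
    set c := 1 - δ / T
    have p1 := mul_pos hc g1
    have p2 := mul_le_mul_of_nonneg_left g2 hc.le
    have p3 := mul_le_mul_of_nonneg_left g3 hc.le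
    refine ⟨by linarith, by linarith, ?_⟩
    have q : c * (τ (k+1) - δ * (1/2 - (1/2)^(k+1+1))) =
      c * (τ k - δ * (1/2 - (1/2)^(k+1))) + c * (τ (k+1) - τ k - δ * (1/2)^(k+2)) := by
      ring
    rw [q]; linarith

lemma step_val {d : ℕ} (a : ℕ → ℝ) (v : ℕ → E d) (w : E d) (T : ℝ) (K : ℕ)
    (ha : ∀ k < K, a k < a (k+1)) (t : ℝ) (j : ℕ) (hj : j < K)
    (ht : t ∈ Set.Ico (a j) (a (j+1))) :
    ∑ k ∈ Finset.range K, Set.indicator (Set.Ico (a k) (a (k + 1))) (fun _ => v k) t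
      + Set.indicator (Set.Icc (a K) T) (fun _ => w) t = v j := by
  have hm : ∀ q ≤ K, ∀ p ≤ q, a p ≤ a q := by
    intro q hq p hp
    induction q, hp using Nat.le_induction with
    | base => exact le_rfl
    | succ q hpq ih => exact (ih (by omega)).trans (ha q (by omega)).le
  rw [sum_step a v K ha t j hj ht, Set.indicator_of_notMem, add_zero]
  rintro ⟨h1, _⟩
  have := hm K le_rfl (j+1) hj
  linarith [ht.2]

lemma step_val_last {d : ℕ} (a : ℕ → ℝ) (v : ℕ → E d) (w : E d) (T : ℝ) (K : ℕ)
    (ha : ∀ k < K, a k < a (k+1)) (t : ℝ) (ht : t ∈ Set.Icc (a K) T) :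
    ∑ k ∈ Finset.range K, Set.indicator (Set.Ico (a k) (a (k + 1))) (fun _ => v k) t
      + Set.indicator (Set.Icc (a K) T) (fun _ => w) t = w := by
  rw [sum_step_zero a v K ha t ht.1, Set.indicator_of_mem ht, zero_add]

/-- Skorokhod-distance bounds between `S` and its discretizations:
`d(S, Π(S)) ≤ √d·2^{-n}`, `d(Π(S), Π̌(S)) ≤ √d·2^{-n}`, `d(Π̌(S), Π̂(S)) ≤ 3√d·2^{-n}`. -/
theorem statement4 (d n : ℕ) (hd : 1 ≤ d) (T : ℝ) (hT : 0 < T)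
    (hδT : Real.sqrt d * 2 ^ (-(n : ℤ)) < T)
    (S : ℝ → E d) (hS : IsCadlagOn d T S) (hScont : ContinuousAtMaturity d T S)
    (hS0 : ∀ i, S 0 i = 1)
    (hSpos : ∀ t ∈ Set.Icc (0:ℝ) T, ∀ i, 0 < S t i) :
    skorokhodDist d T S (piPlain d n T S) ≤ Real.sqrt d * 2 ^ (-(n : ℤ)) ∧
    skorokhodDist d T (piPlain d n T S) (piCheck d n T S) ≤ Real.sqrt d * 2 ^ (-(n : ℤ)) ∧
    skorokhodDist d T (piCheck d n T S) (hatPi d n T S) ≤ 3 * (Real.sqrt d * 2 ^ (-(n : ℤ))) := by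
  have hδ : 0 < Real.sqrt d * 2 ^ (-(n : ℤ)) := by
    have : 0 < Real.sqrt d := Real.sqrt_pos.2 (by exact_mod_cast hd)
    positivity
  unfold piPlain piCheck hatPi
  have hrs := fun m hm z => round_sub d n m hm z
  have hrd := fun m m' hm hm' z w => round_diff d n m m' hm hm' z w
  have hgb := fun τ M h0 hτ k hk => grid_bounds d n hd T hδT τ M h0 hτ k hk
  have hgl : ∀ τ M, 1 ≤ M → gridTimes d n T τ M (M+1) = T := by
    intro τ M hM
    obtain ⟨m, rfl⟩ : ∃ m, M = m + 1 := ⟨M - 1, by omega⟩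
    rw [gridTimes, if_neg (by omega)]
  have hg0 : ∀ τ M, gridTimes d n T τ M 0 = 0 := fun τ M => by rw [gridTimes]
  dsimp only
  generalize Real.sqrt d * 2 ^ (-(n : ℤ)) = δ at *
  have hfin := exit_finite hT hδ hS
  have hM1 : exitTimes d T δ S (exitCount d T δ S) = T := Nat.sInf_mem hfin
  have hM2 : ∀ k < exitCount d T δ S, exitTimes d T δ S k ≠ T := fun k hk h =>
    Nat.notMem_of_lt_sInf hk h
  have hτ0 : exitTimes d T δ S 0 = 0 := by rw [exitTimes]
  have hstep := fun k h0 h1 => exit_step hδ hS k h0 h1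
  generalize exitCount d T δ S = M at *
  generalize exitTimes d T δ S = τ at *
  obtain ⟨N, rfl⟩ : ∃ N, M = N + 1 := by
    rcases M with _ | N
    · rw [hτ0] at hM1; linarith
    · exact ⟨N, rfl⟩
  simp only [Nat.add_sub_cancel]
  have hb : ∀ k < N + 1, 0 ≤ τ k ∧ τ k < T := by
    intro k hk
    induction k with
    | zero => rw [hτ0]; exact ⟨le_rfl, hT⟩
    | succ k ih =>
      obtain ⟨i1, i2⟩ := ih (by omega)
      obtain ⟨h1, h2, _⟩ := hstep k i1 i2
      exact ⟨i1.trans h1.le, lt_of_le_of_ne h2 (hM2 _ hk)⟩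
  have hst := fun k hk => hstep k (hb k hk).1 (hb k hk).2
  clear hstep
  have hmono : ∀ k < N + 1, τ k < τ (k+1) := fun k hk => (hst k hk).1
  have hmonoN : ∀ k < N, τ k < τ (k+1) := fun k hk => hmono k (by omega)
  have hNT : τ N < T := (hb N (by omega)).2
  have hN0 : 0 ≤ τ N := (hb N (by omega)).1
  have hNδ : T ≤ τ N + δ := by have := (hst N (by omega)).2.2.1; rwa [hM1] at this
  have hosc : ∀ k < N + 1, ∀ t ∈ Set.Ico (τ k) (τ (k+1)), ‖S t - S (τ k)‖ ≤ δ := by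
    intro k hk t ht
    rcases eq_or_lt_of_le ht.1 with h | h
    · rw [h, sub_self, norm_zero]; exact hδ.le
    · exact ((hst k hk).2.2.2.1 t h ht.2).le
  have hoscT : ‖S T - S (τ N)‖ ≤ δ := by
    have hc : Tendsto S (nhdsWithin T (Set.Iio T)) (nhds (S T)) := by
      have h := hScont
      unfold ContinuousAtMaturity at h
      rwa [nhdsWithin_Ico_eq_nhdsLT hT] at h
    have hc' : Tendsto (fun t => ‖S t - S (τ N)‖) (nhdsWithin T (Set.Iio T))
        (nhds ‖S T - S (τ N)‖) := (hc.sub_const _).norm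
    apply le_of_tendsto hc'
    filter_upwards [Ioo_mem_nhdsLT hNT] with t ht
    apply hosc N (by omega) t
    rw [hM1]
    exact ⟨ht.1.le, ht.2⟩
  refine ⟨?_, ?_, ?_⟩
  · apply skd_le_id hT
    intro t ht
    rcases lt_or_ge t (τ N) with h | h
    · obtain ⟨j, hj, hh⟩ := locate τ N t (by rw [hτ0]; exact ht.1) h
      rw [step_val τ (fun k => S (τ k)) _ T N hmonoN t j hj hh]
      exact hosc j (by omega) t hh
    · rw [step_val_last τ (fun k => S (τ k)) _ T N hmonoN t ⟨h, ht.2⟩]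
      rcases eq_or_lt_of_le ht.2 with h' | h'
      · rw [h']; exact hoscT
      · exact hosc N (by omega) t (by rw [hM1]; exact ⟨h, h'⟩)
  · apply skd_le_id hT
    intro t ht
    rcases lt_or_ge t (τ N) with h | h
    · obtain ⟨j, hj, hh⟩ := locate τ N t (by rw [hτ0]; exact ht.1) h
      rw [step_val τ (fun k => S (τ k)) _ T N hmonoN t j hj hh,
        step_val τ (fun k => dyadicRound d (n + k) (S (τ k))) _ T N hmonoN t j hj hh]
      exact hrs _ (by omega) _
    · rw [step_val_last τ (fun k => S (τ k)) _ T N hmonoN t ⟨h, ht.2⟩,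
        step_val_last τ (fun k => dyadicRound d (n + k) (S (τ k))) _ T N hmonoN t ⟨h, ht.2⟩]
      exact hrs _ le_rfl _
  · have hg := hgb τ (N+1) hτ0 hmono
    have hgT := hgl τ (N+1) (by omega)
    have hgz := hg0 τ (N+1)
    generalize gridTimes d n T τ (N+1) = g at *
    have hq0 : 0 < δ / T := div_pos hδ hT
    have hq1 : δ / T < 1 := (div_lt_one hT).2 hδT
    have hqT : δ / T * T = δ := by field_simp
    -- simplified grid bounds
    have hup : ∀ k, k + 1 ≤ N + 1 → g (k+1) ≤ τ k + δ - δ / T * τ k := by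
      intro k hk
      have := (hg k hk).2.1
      linarith
    have hlo : ∀ k, k + 1 ≤ N + 1 → τ k - δ / 2 ≤ g (k+1) := by
      intro k hk
      have h3 := (hg k hk).2.2
      have hp : (0:ℝ) < (1/2)^(k+1) := by positivity
      have a1 : δ / T * τ k ≤ δ := by
        calc δ / T * τ k ≤ δ / T * T := mul_le_mul_of_nonneg_left (hb k (by omega)).2.le hq0.le
          _ = δ := hqT
      have a2 : δ * (1/2 - (1/2)^(k+1)) ≤ δ / 2 := by
        have := mul_pos hδ hp
        linarith
      have a3 := mul_le_mul_of_nonneg_left a2 (by linarith : 0 ≤ 1 - δ / T)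
      have a4 : 0 ≤ δ / T * (δ / 2) := by positivity
      linarith
    have hgmono : ∀ k < N + 1, g k < g (k+1) := fun k hk => (hg k hk).1
    have hgM : g (N+1) < T := by
      have h1 := hup N le_rfl
      have h2 : (1 - δ / T) * τ N < (1 - δ / T) * T := mul_lt_mul_of_pos_left hNT (by linarith)
      linarith
    obtain ⟨x, hx1, hx2, hx3⟩ : ∃ x : ℕ → ℝ, (∀ k ≤ N, x k = τ k) ∧ x (N+1) = (τ N + T) / 2 ∧
        x (N+1+1) = T := by
      refine ⟨fun k => if k ≤ N then τ k else if k = N + 1 then (τ N + T) / 2 else T, ?_, ?_, ?_⟩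
      · intro k hk; simp [hk]
      · simp
      · simp
    have hxm : ∀ k < N + 1 + 1, x k < x (k+1) := by
      intro k hk
      rcases lt_trichotomy k N with h | h | h
      · rw [hx1 k h.le, hx1 (k+1) h]; exact hmonoN k h
      · rw [h, hx1 N le_rfl, hx2]; linarith
      · obtain rfl : k = N + 1 := by omega
        rw [hx2, hx3]; linarith
    have hym : ∀ k < N + 1 + 1, g k < g (k+1) := by
      intro k hk
      rcases Nat.lt_or_ge k (N+1) with h | h
      · exact hgmono k h
      · obtain rfl : k = N + 1 := by omega
        rw [hgT]; exact hgM
    have hx0 : x 0 = 0 := by rw [hx1 0 (by omega), hτ0]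
    obtain ⟨lam, lm, ls, ln, lb⟩ := pw_linear x g (N+1+1) hxm hym
    have l0 : lam 0 = 0 := by have := ln 0 (by omega); rwa [hx0, hgz] at this
    have lT : lam T = T := by have := ln (N+1+1) le_rfl; rwa [hx3, hgT] at this
    -- node errors
    have e1 : ∀ k ≤ N, |g k - x k| ≤ 3 / 2 * δ := by
      intro k hk
      rw [hx1 k hk]
      rcases k with _ | k
      · rw [hgz, hτ0, sub_self, abs_zero]; positivity
      · have b1 := hup k (by omega)
        have b2 := hlo k (by omega)
        have b3 := (hst k (by omega)).2.2.1
        have b4 := hmono k (by omega)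
        have b5 : 0 ≤ δ / T * τ k := mul_nonneg hq0.le (hb k (by omega)).1
        rw [abs_le]
        constructor <;> linarith
    have e2 : |g (N+1) - x (N+1)| ≤ δ := by
      rw [hx2]
      have b1 := hup N le_rfl
      have b2 := hlo N le_rfl
      have b5 : 0 ≤ δ / T * τ N := mul_nonneg hq0.le hN0
      rw [abs_le]
      constructor <;> linarith
    have e3 : |g (N+1+1) - x (N+1+1)| ≤ δ := by
      rw [hgT, hx3, sub_self, abs_zero]; exact hδ.le
    apply skd_le hT lam (lm.strictMonoOn _)
    · refine ⟨?_, lm.injective.injOn, ?_⟩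
      · intro t ht
        refine ⟨?_, ?_⟩
        · rw [← l0]; exact lm.monotone ht.1
        · rw [← lT]; exact lm.monotone ht.2
      · intro z hz
        obtain ⟨t, rfl⟩ := ls z
        refine ⟨t, ⟨?_, ?_⟩, rfl⟩
        · rw [← lm.le_iff_le, l0]; exact hz.1
        · rw [← lm.le_iff_le, lT]; exact hz.2
    · intro t ht
      have hmem : ∀ k ≤ N + 1, t ∈ Set.Ico (x k) (x (k+1)) → lam t ∈ Set.Ico (g k) (g (k+1)) := by
        intro k hk hh
        rw [← ln k (by omega), ← ln (k+1) (by omega)]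
        exact ⟨lm.monotone hh.1, lm hh.2⟩
      rcases lt_or_ge t (x (N+1)) with h | h
      · obtain ⟨j, hj, hh⟩ := locate x (N+1) t (by rw [hx0]; exact ht.1) h
        rw [step_val g (fun k => dyadicRound d (n + k) (S (τ k))) _ T (N+1) hgmono (lam t) j hj
          (hmem j (by omega) hh)]
        have e2' : |g (N+1) - x (N+1)| ≤ 3 / 2 * δ := e2.trans (by linarith)
        have hl : |lam t - t| ≤ 3 / 2 * δ := by
          apply lb j (by omega) t ⟨hh.1, hh.2.le⟩ _ (e1 j (by omega))
          rcases Nat.lt_or_ge j N with h' | h'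
          · exact e1 (j+1) h'
          · obtain rfl : j = N := by omega
            exact e2'
        rcases Nat.lt_or_ge j N with h' | h'
        · rw [hx1 j h'.le, hx1 (j+1) h'] at hh
          rw [step_val τ (fun k => dyadicRound d (n + k) (S (τ k))) _ T N hmonoN t j h' hh,
            sub_self, norm_zero]
          linarith
        · obtain rfl : j = N := by omega
          rw [hx1 j le_rfl] at hh
          rw [step_val_last τ (fun k => dyadicRound d (n + k) (S (τ k))) _ T j hmonoN t
            ⟨hh.1, ht.2⟩]
          have := hrd n (n + j) le_rfl (by omega) (S (τ j)) (S (τ j))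
          rw [sub_self, norm_zero] at this
          linarith
      · have hl : |lam t - t| ≤ δ := lb (N+1) (by omega) t ⟨h, by rw [hx3]; exact ht.2⟩ _ e2 e3
        have hlt : lam t ∈ Set.Icc (g (N+1)) T := by
          refine ⟨?_, ?_⟩
          · rw [← ln (N+1) (by omega)]; exact lm.monotone h
          · rw [← lT]; exact lm.monotone ht.2
        rw [step_val_last g (fun k => dyadicRound d (n + k) (S (τ k))) _ T (N+1) hgmono _ hlt,
          step_val_last τ (fun k => dyadicRound d (n + k) (S (τ k))) _ T N hmonoN t
            ⟨by rw [hx2] at h; linarith, ht.2⟩]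
        have := hrd n n le_rfl le_rfl (S (τ N)) (S T)
        rw [norm_sub_rev (S (τ N))] at this
        linarith

end
end

section
/- Let n ≥ 1 and M ≥ 1 be integers, let x_0, x_1, …, x_M ∈ (0,∞)^d with π^{(n)}(x_0) = x_0, and let γ_1, …, γ_M ∈ ℝ^d satisfy |γ_k| ≤ n (Euclidean norm) for every k. Then | Σ_{k=1}^{M} γ_k · [ (π^{(n+k)}(x_k) − π^{(n+k−1)}(x_{k−1})) − (x_k − x_{k−1}) ] | ≤ √d · n · 2^{-n+1}, where · denotes the Euclidean inner product on ℝ^d. -/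
open Filter Set

noncomputable section

/-- Rounding error bound. -/
theorem dyadicRound_err (d m : ℕ) (x : E d) :
    ‖dyadicRound d m x - x‖ ≤ Real.sqrt d * ((2 : ℝ) ^ m)⁻¹ := by
  have hp : (0 : ℝ) < 2 ^ m := by positivity
  rw [EuclideanSpace.norm_eq]
  have h : ∀ i, ‖(dyadicRound d m x - x) i‖ ^ 2 ≤ (((2 : ℝ) ^ m)⁻¹) ^ 2 := by
    intro i
    have e : (dyadicRound d m x - x) i
        = ((2 : ℝ) ^ m)⁻¹ * ((⌈(2 : ℝ) ^ m * x i⌉ : ℤ) - (2 : ℝ) ^ m * x i) := by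
      simp only [dyadicRound, PiLp.sub_apply, zpow_neg, zpow_natCast]
      field_simp
    have h1 := Int.le_ceil ((2 : ℝ) ^ m * x i)
    have h2 := Int.ceil_lt_add_one ((2 : ℝ) ^ m * x i)
    rw [e, norm_mul, Real.norm_of_nonneg (inv_pos.2 hp).le, Real.norm_of_nonneg (by linarith)]
    apply pow_le_pow_left₀ (mul_nonneg (inv_pos.2 hp).le (by linarith))
    exact mul_le_of_le_one_right (inv_pos.2 hp).le (by linarith)
  calc _ ≤ Real.sqrt (∑ _i : Fin d, (((2 : ℝ) ^ m)⁻¹) ^ 2) :=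
        Real.sqrt_le_sqrt (Finset.sum_le_sum fun i _ => h i)
    _ = _ := by
        rw [Finset.sum_const, Finset.card_univ, Fintype.card_fin, nsmul_eq_mul,
          Real.sqrt_mul (Nat.cast_nonneg d), Real.sqrt_sq (inv_pos.2 hp).le]

/-- One term of the sum. -/
theorem term_bound (d n a b : ℕ) (x y g : E d) (hg : ‖g‖ ≤ (n : ℝ)) :
    |(inner ℝ g ((dyadicRound d a x - dyadicRound d b y) - (x - y)) : ℝ)|
      ≤ n * (‖dyadicRound d a x - x‖ + ‖dyadicRound d b y - y‖) := by
  have e : (dyadicRound d a x - dyadicRound d b y) - (x - y)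
      = (dyadicRound d a x - x) - (dyadicRound d b y - y) := by abel
  rw [e]
  refine (abs_real_inner_le_norm _ _).trans ?_
  exact mul_le_mul hg (norm_sub_le _ _) (norm_nonneg _) (Nat.cast_nonneg n)

/-- Sharper partial sum bound. -/
theorem partial_bound (d n : ℕ) (x : ℕ → E d) (hx0 : dyadicRound d n (x 0) = x 0)
    (γ : ℕ → E d) (M : ℕ) (hM : 1 ≤ M) (hγ : ∀ k, 1 ≤ k → k ≤ M → ‖γ k‖ ≤ (n : ℝ)) :
    |∑ k ∈ Finset.Icc 1 M,
        (inner ℝ (γ k)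
          ((dyadicRound d (n + k) (x k) - dyadicRound d (n + k - 1) (x (k - 1)))
            - (x k - x (k - 1))) : ℝ)|
      ≤ Real.sqrt d * (n : ℝ) * ((2 : ℝ) ^ n)⁻¹ * (2 - 3 * ((2 : ℝ) ^ M)⁻¹) := by
  induction M, hM using Nat.le_induction with
  | base =>
    have h := term_bound d n (n + 1) (n + 1 - 1) (x 1) (x (1 - 1)) (γ 1) (hγ 1 le_rfl le_rfl)
    have h1 := dyadicRound_err d (n + 1) (x 1)
    rw [Finset.Icc_self, Finset.sum_singleton]
    refine h.trans ?_
    simp only [Nat.add_sub_cancel, Nat.sub_self, hx0, sub_self, norm_zero, add_zero]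
    refine (mul_le_mul_of_nonneg_left h1 (Nat.cast_nonneg n)).trans (le_of_eq ?_)
    rw [pow_succ, mul_inv]
    ring
  | succ M hM ih =>
    have ih := ih fun k h1 h2 => hγ k h1 (by omega)
    have h := term_bound d n (n + (M + 1)) (n + (M + 1) - 1) (x (M + 1)) (x (M + 1 - 1))
      (γ (M + 1)) (hγ _ (by omega) le_rfl)
    have h1 := dyadicRound_err d (n + (M + 1)) (x (M + 1))
    have h2 := dyadicRound_err d (n + (M + 1) - 1) (x (M + 1 - 1))
    rw [Finset.sum_Icc_succ_top (by omega)]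
    refine (abs_add_le _ _).trans ((add_le_add ih (h.trans
      (mul_le_mul_of_nonneg_left (add_le_add h1 h2) (Nat.cast_nonneg n)))).trans (le_of_eq ?_))
    have e : n + (M + 1) - 1 = n + M := by omega
    rw [e]
    simp only [pow_add, pow_one, mul_inv]
    ring

/-- for `n, M ≥ 1`, points `x_0,…,x_M ∈ (0,∞)^d` with `π^{(n)}(x_0) = x_0`
and vectors `γ_1,…,γ_M` of Euclidean norm at most `n`,
`|Σ_{k=1}^M ⟪γ_k, (π^{(n+k)}(x_k) − π^{(n+k−1)}(x_{k−1})) − (x_k − x_{k−1})⟫| ≤ √d·n·2^{-n+1}`. -/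
theorem statement6 (d n M : ℕ) (hd : 1 ≤ d) (hn : 1 ≤ n) (hM : 1 ≤ M)
    (x : ℕ → E d) (hxpos : ∀ k ≤ M, ∀ i, 0 < x k i)
    (hx0 : dyadicRound d n (x 0) = x 0)
    (γ : ℕ → E d) (hγ : ∀ k, 1 ≤ k → k ≤ M → ‖γ k‖ ≤ (n : ℝ)) :
    |∑ k ∈ Finset.Icc 1 M,
        (inner ℝ (γ k)
          ((dyadicRound d (n + k) (x k) - dyadicRound d (n + k - 1) (x (k - 1)))
            - (x k - x (k - 1))) : ℝ)|
      ≤ Real.sqrt d * (n : ℝ) * 2 ^ (-(n : ℤ) + 1) := by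
  refine (partial_bound d n x hx0 γ M hM hγ).trans ?_
  rw [zpow_add₀ two_ne_zero, zpow_neg, zpow_natCast, zpow_one, ← mul_assoc]
  apply mul_le_mul_of_nonneg_left _ (by positivity)
  have : (0 : ℝ) < ((2 : ℝ) ^ M)⁻¹ := by positivity
  linarith

end
end

section
/- Let n ∈ ℕ with √d·2^{-n} < T. Let γ̂ : [0,T] × D → ℝ^d be a predictable functional, i.e. for every t ∈ [0,T] and every S, S̃ ∈ D with S_u = S̃_u for all u ∈ [0,t), one has γ̂_t(S) = γ̂_t(S̃). For S ∈ D, with τ_k(S), M(S), τ̂_k(S) and Π̂(S) defined from S as below, set γ_0(S) := 0 and γ_t(S) := Σ_{k=0}^{M(S)−1} γ̂_{τ̂_{k+1}(S)}(Π̂(S)) · 1_{(τ_k(S), τ_{k+1}(S)]}(t) for t ∈ (0,T]. Then γ is progressively measurable in the pathwise sense: for every t ∈ [0,T] and every S, S̃ ∈ D with S_u = S̃_u for all u ∈ [0,t], one has γ_t(S) = γ_t(S̃). -/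
open Filter Set
open scoped Classical

noncomputable section

/-- The path space `D`: càdlàg paths with values in `(0,∞)^d`, starting at `(1,…,1)`,
continuous at `T`. -/
def DPos (d : ℕ) (T : ℝ) : Set (ℝ → E d) :=
  {f | IsCadlagOn d T f ∧ ContinuousAtMaturity d T f ∧ (∀ i, f 0 i = 1) ∧
    ∀ t ∈ Set.Icc (0:ℝ) T, ∀ i, 0 < f t i}

/-- The lifted dynamic strategy
`γ_t(S) = Σ_{k=0}^{M−1} γ̂_{τ̂_{k+1}(S)}(Π̂(S)) 1_{(τ_k(S), τ_{k+1}(S)]}(t)` (and `γ_0(S) = 0`). -/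
def liftedGamma (d n : ℕ) (T : ℝ) (γh : ℝ → (ℝ → E d) → E d) (S : ℝ → E d) (t : ℝ) : E d :=
  let δ := Real.sqrt d * 2 ^ (-(n : ℤ))
  let τ := exitTimes d T δ S
  let M := exitCount d T δ S
  let τh := gridTimes d n T τ M
  ∑ k ∈ Finset.range M,
    Set.indicator (Set.Ioc (τ k) (τ (k + 1))) (fun _ => γh (τh (k + 1)) (hatPi d n T S)) t

theorem aux_le_succ (d : ℕ) (T δ : ℝ) (f : ℝ → E d) (k : ℕ) (u : ℝ) :
    u ≤ exitTimes d T δ f (k+1) ↔ u ≤ T ∧ u ≤ exitTimes d T δ f k + δ ∧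
      ∀ s, exitTimes d T δ f k < s → s < u → ‖f s - f (exitTimes d T δ f k)‖ < δ := by
  rw [exitTimes]
  set a := exitTimes d T δ f k
  split_ifs with h
  · rw [le_min_iff, le_min_iff]
    have hb : BddBelow {t : ℝ | a < t ∧ δ ≤ ‖f t - f a‖} := ⟨a, fun x hx => hx.1.le⟩
    rw [le_csInf_iff hb h]
    refine and_congr Iff.rfl (and_congr Iff.rfl ⟨fun H s h1 h2 => ?_, fun H s hs => ?_⟩)
    · by_contra h3
      exact absurd (H s ⟨h1, not_lt.1 h3⟩) (not_le.2 h2)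
    · by_contra h3
      exact absurd (H s hs.1 (not_le.1 h3)) (not_lt.2 hs.2)
  · rw [le_min_iff]
    refine and_congr Iff.rfl ⟨fun H => ⟨H, fun s h1 h2 => ?_⟩, fun H => H.1⟩
    by_contra h3
    exact h ⟨s, h1, not_lt.1 h3⟩

theorem aux_le_T (d : ℕ) (T δ : ℝ) (hT : 0 < T) (f : ℝ → E d) (k : ℕ) :
    exitTimes d T δ f k ≤ T := by
  cases k with
  | zero => simpa [exitTimes] using hT.le
  | succ k => exact ((aux_le_succ d T δ f k _).1 le_rfl).1

theorem aux_le_next (d : ℕ) (T δ : ℝ) (hT : 0 < T) (hδ : 0 < δ) (f : ℝ → E d) (k : ℕ) :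
    exitTimes d T δ f k ≤ exitTimes d T δ f (k+1) := by
  rw [aux_le_succ]
  exact ⟨aux_le_T d T δ hT f k, by linarith, fun s h1 h2 => absurd h1 h2.not_gt⟩

theorem aux_mono (d : ℕ) (T δ : ℝ) (hT : 0 < T) (hδ : 0 < δ) (f : ℝ → E d) :
    Monotone (exitTimes d T δ f) :=
  monotone_nat_of_le_succ (aux_le_next d T δ hT hδ f)

theorem aux_nonneg (d : ℕ) (T δ : ℝ) (hT : 0 < T) (hδ : 0 < δ) (f : ℝ → E d) (k : ℕ) :
    0 ≤ exitTimes d T δ f k := by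
  have := aux_mono d T δ hT hδ f (Nat.zero_le k)
  simpa [exitTimes] using this

theorem aux_strict (d : ℕ) (T δ : ℝ) (hT : 0 < T) (hδ : 0 < δ) (f : ℝ → E d)
    (hf : IsCadlagOn d T f) (k : ℕ) (hk : exitTimes d T δ f k < T) :
    exitTimes d T δ f k < exitTimes d T δ f (k+1) := by
  set a := exitTimes d T δ f k with ha
  have h0 : 0 ≤ a := aux_nonneg d T δ hT hδ f k
  have h1 := hf.1 a ⟨h0, hk⟩
  rw [Metric.tendsto_nhdsWithin_nhds] at h1
  obtain ⟨ε, hε, h2⟩ := h1 δ hδ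
  have h3 : min T (min (a + δ) (a + ε)) ≤ exitTimes d T δ f (k+1) := by
    rw [aux_le_succ]
    refine ⟨min_le_left _ _, (min_le_right _ _).trans (min_le_left _ _), fun s hs1 hs2 => ?_⟩
    rw [lt_min_iff, lt_min_iff] at hs2
    rw [← ha] at hs1 ⊢
    have := h2 (x := s) ⟨hs1, hs2.1⟩ (by
      rw [Real.dist_eq, abs_of_pos (by linarith)]; linarith [hs2.2.2])
    rwa [dist_eq_norm] at this
  refine lt_of_lt_of_le ?_ h3
  rw [lt_min_iff, lt_min_iff]
  exact ⟨hk, by linarith, by linarith⟩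

theorem aux_finite (d : ℕ) (T δ : ℝ) (hT : 0 < T) (hδ : 0 < δ) (f : ℝ → E d)
    (hf : IsCadlagOn d T f) : ∃ k, exitTimes d T δ f k = T := by
  by_contra hne
  push Not at hne
  have hlt : ∀ k, exitTimes d T δ f k < T := fun k => lt_of_le_of_ne (aux_le_T d T δ hT f k) (hne k)
  have hbdd : BddAbove (range (exitTimes d T δ f)) := ⟨T, by rintro _ ⟨k, rfl⟩; exact (hlt k).le⟩
  set L := ⨆ k, exitTimes d T δ f k with hL
  have hs := fun k => aux_strict d T δ hT hδ f hf k (hlt k)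
  have hltL : ∀ k, exitTimes d T δ f k < L := fun k => (hs k).trans_le (le_ciSup hbdd (k+1))
  have hLT : L ≤ T := ciSup_le fun k => (hlt k).le
  have hL0 : 0 < L := by
    have := hltL 0
    simpa [exitTimes] using this
  obtain ⟨c, hc⟩ := hf.2 L ⟨hL0, hLT⟩
  rw [Metric.tendsto_nhdsWithin_nhds] at hc
  obtain ⟨ε, hε, h2⟩ := hc (δ/2) (by linarith)
  obtain ⟨k, hk⟩ := exists_lt_of_lt_ciSup
    (show max (L - ε) (L - δ) < ⨆ k, exitTimes d T δ f k by
      rw [← hL, max_lt_iff]; constructor <;> linarith)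
  rw [max_lt_iff] at hk
  have h3 : L ≤ exitTimes d T δ f (k+1) := by
    rw [aux_le_succ]
    refine ⟨hLT, by linarith, fun s hs1 hs2 => ?_⟩
    have h0 := aux_nonneg d T δ hT hδ f k
    have e1 := h2 (x := s) ⟨by linarith, hs2⟩ (by
      rw [Real.dist_eq, abs_of_neg (by linarith)]; linarith)
    have e2 := h2 (x := exitTimes d T δ f k) ⟨h0, hltL k⟩ (by
      rw [Real.dist_eq, abs_of_neg (by linarith [hltL k])]; linarith)
    rw [← dist_eq_norm]
    have := dist_triangle_right (f s) (f (exitTimes d T δ f k)) c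
    linarith
  exact absurd h3 (not_le.2 (hltL (k+1)))

theorem aux_M (d : ℕ) (T δ : ℝ) (hT : 0 < T) (hδ : 0 < δ) (f : ℝ → E d)
    (hf : IsCadlagOn d T f) : exitTimes d T δ f (exitCount d T δ f) = T :=
  Nat.sInf_mem (s := {k : ℕ | exitTimes d T δ f k = T}) (aux_finite d T δ hT hδ f hf)

theorem aux_lt_M (d : ℕ) (T δ : ℝ) (hT : 0 < T) (f : ℝ → E d) (k : ℕ)
    (hk : k < exitCount d T δ f) : exitTimes d T δ f k < T :=
  lt_of_le_of_ne (aux_le_T d T δ hT f k) (Nat.notMem_of_lt_sInf hk)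

theorem aux_agree (d : ℕ) (T δ : ℝ) (hT : 0 < T) (hδ : 0 < δ) (f g : ℝ → E d) (t : ℝ)
    (hfg : ∀ u ∈ Icc (0:ℝ) t, f u = g u) (k : ℕ) :
    exitTimes d T δ f k = exitTimes d T δ g k ∨
      (t ≤ exitTimes d T δ f k ∧ t ≤ exitTimes d T δ g k) := by
  induction k with
  | zero => left; simp [exitTimes]
  | succ k ih =>
    by_cases hb : t ≤ exitTimes d T δ f k ∧ t ≤ exitTimes d T δ g k
    · right
      exact ⟨hb.1.trans (aux_le_next d T δ hT hδ f k), hb.2.trans (aux_le_next d T δ hT hδ g k)⟩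
    have he := ih.resolve_right hb
    have ht : exitTimes d T δ f k < t := by
      by_contra h
      exact hb ⟨not_lt.1 h, he ▸ not_lt.1 h⟩
    have h0 := aux_nonneg d T δ hT hδ f k
    have key : ∀ u ≤ t, u ≤ exitTimes d T δ f (k+1) ↔ u ≤ exitTimes d T δ g (k+1) := by
      intro u hu
      rw [aux_le_succ, aux_le_succ, ← he]
      refine and_congr Iff.rfl (and_congr Iff.rfl (forall_congr' fun s => ?_))
      refine forall_congr' fun h1 => forall_congr' fun h2 => ?_
      rw [hfg s ⟨by linarith, by linarith⟩, hfg _ ⟨h0, ht.le⟩]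
    by_cases h1 : t ≤ exitTimes d T δ f (k+1)
    · exact Or.inr ⟨h1, (key t le_rfl).1 h1⟩
    · have h2 : ¬ t ≤ exitTimes d T δ g (k+1) := fun h => h1 ((key t le_rfl).2 h)
      left
      exact le_antisymm ((key _ (not_le.1 h1).le).1 le_rfl) ((key _ (not_le.1 h2).le).2 le_rfl)

theorem aux_sup (d i : ℕ) (hd : 1 ≤ d) (Δ : ℝ) (hΔ : 0 < Δ) :
    0 < sSup {s : ℝ | s ∈ Bset d i ∧ s < Δ} ∧ sSup {s : ℝ | s ∈ Bset d i ∧ s < Δ} ≤ Δ := by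
  have hdp : (0:ℝ) < Real.sqrt d * 2 ^ (-(i : ℤ)) := by
    have : (0:ℝ) < d := by exact_mod_cast hd
    positivity
  set b := Real.sqrt d * 2 ^ (-(i : ℤ)) with hb
  obtain ⟨N, hN⟩ := exists_nat_gt (b / Δ)
  have hN0 : (0:ℝ) < N := lt_trans (by positivity) hN
  have hmem : b / N ∈ {s : ℝ | s ∈ Bset d i ∧ s < Δ} := by
    refine ⟨Or.inr ⟨N, by exact_mod_cast hN0, rfl⟩, ?_⟩
    rw [div_lt_iff₀ hΔ] at hN
    rw [div_lt_iff₀ hN0]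
    linarith
  have hbd : BddAbove {s : ℝ | s ∈ Bset d i ∧ s < Δ} := ⟨Δ, fun x hx => hx.2.le⟩
  exact ⟨lt_of_lt_of_le (by positivity) (le_csSup hbd hmem), csSup_le ⟨_, hmem⟩ fun x hx => hx.2.le⟩

theorem aux_grid_lt (d n : ℕ) (hd : 1 ≤ d) (T : ℝ) (hT : 0 < T)
    (hδT : Real.sqrt d * 2 ^ (-(n : ℤ)) < T) (τ : ℕ → ℝ) (M : ℕ)
    (hτ : ∀ k < M, τ k < τ (k+1)) (k : ℕ) (hk : k < M) :
    gridTimes d n T τ M k < gridTimes d n T τ M (k+1) := by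
  have hdp : (0:ℝ) < Real.sqrt d * 2 ^ (-(n : ℤ)) := by
    have : (0:ℝ) < d := by exact_mod_cast hd
    positivity
  cases k with
  | zero => simpa only [gridTimes] using hdp
  | succ k =>
    have h1 := (aux_sup d (n + (k+2)) hd _ (sub_pos.2 (hτ k (by omega)))).1
    have h2 : 0 < 1 - Real.sqrt d * 2 ^ (-(n : ℤ)) / T := by
      rw [sub_pos, div_lt_one hT]; exact hδT
    have h3 := mul_pos h2 h1
    conv_rhs => rw [gridTimes]
    rw [if_pos (by omega)]
    linarith

theorem aux_grid_le (d n : ℕ) (hd : 1 ≤ d) (T : ℝ) (hT : 0 < T)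
    (hδT : Real.sqrt d * 2 ^ (-(n : ℤ)) < T) (τ : ℕ → ℝ) (M : ℕ) (h0 : τ 0 = 0)
    (hτ : ∀ k < M, τ k < τ (k+1)) (k : ℕ) (hk : k < M) :
    gridTimes d n T τ M (k+1) ≤ Real.sqrt d * 2 ^ (-(n : ℤ)) +
      (1 - Real.sqrt d * 2 ^ (-(n : ℤ)) / T) * τ k := by
  induction k with
  | zero => simp [gridTimes, h0]
  | succ k ih =>
    have h1 := (aux_sup d (n + (k+2)) hd _ (sub_pos.2 (hτ k (by omega)))).2
    have h2 : 0 < 1 - Real.sqrt d * 2 ^ (-(n : ℤ)) / T := by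
      rw [sub_pos, div_lt_one hT]; exact hδT
    have h3 := mul_le_mul_of_nonneg_left h1 h2.le
    have h4 := ih (by omega)
    rw [gridTimes]
    rw [if_pos (by omega)]
    linarith

theorem aux_grid_congr (d n : ℕ) (T : ℝ) (τ τ' : ℕ → ℝ) (M M' K : ℕ)
    (hM : K < M) (hM' : K < M') (h : ∀ k ≤ K, τ k = τ' k) (k : ℕ) (hk : k ≤ K + 1) :
    gridTimes d n T τ M k = gridTimes d n T τ' M' k := by
  induction k with
  | zero => simp [gridTimes]
  | succ k ih =>
    cases k with
    | zero => simp [gridTimes]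
    | succ k =>
      rw [gridTimes, gridTimes, if_pos (by omega), if_pos (by omega), ih (by omega),
        h k (by omega), h (k+1) (by omega)]

/-- The collected facts about the grid of a path in `D`. -/
structure GridFacts (d n : ℕ) (T : ℝ) (τ : ℕ → ℝ) (M : ℕ) (σ : ℕ → ℝ) : Prop where
  tau_zero : τ 0 = 0
  tau_M : τ M = T
  tau_mono : Monotone τ
  tau_lt : ∀ k < M, τ k < T
  zero : σ 0 = 0
  lt : ∀ k < M, σ k < σ (k+1)
  lt_T : σ M < T
  pos : 0 < M

theorem aux_facts (d n : ℕ) (hd : 1 ≤ d) (T : ℝ) (hT : 0 < T)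
    (hδT : Real.sqrt d * 2 ^ (-(n : ℤ)) < T) (f : ℝ → E d) (hf : IsCadlagOn d T f) :
    GridFacts d n T (exitTimes d T (Real.sqrt d * 2 ^ (-(n : ℤ))) f)
      (exitCount d T (Real.sqrt d * 2 ^ (-(n : ℤ))) f)
      (gridTimes d n T (exitTimes d T (Real.sqrt d * 2 ^ (-(n : ℤ))) f)
      (exitCount d T (Real.sqrt d * 2 ^ (-(n : ℤ))) f)) := by
  have hdp : (0:ℝ) < Real.sqrt d * 2 ^ (-(n : ℤ)) := by
    have : (0:ℝ) < d := by exact_mod_cast hd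
    positivity
  have hz : exitTimes d T (Real.sqrt d * 2 ^ (-(n : ℤ))) f 0 = 0 := by simp [exitTimes]
  have hst := fun k hk => aux_strict d T _ hT hdp f hf k (aux_lt_M d T _ hT f k hk)
  have hMM := aux_M d T _ hT hdp f hf
  have hpos : 0 < exitCount d T (Real.sqrt d * 2 ^ (-(n : ℤ))) f := by
    by_contra h
    have h' : exitCount d T (Real.sqrt d * 2 ^ (-(n : ℤ))) f = 0 := by omega
    rw [h', hz] at hMM
    exact hT.ne hMM
  refine ⟨hz, hMM, aux_mono d T _ hT hdp f, fun k hk => aux_lt_M d T _ hT f k hk, by simp [gridTimes],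
    aux_grid_lt d n hd T hT hδT _ _ hst, ?_, hpos⟩
  obtain ⟨m, hm⟩ := Nat.exists_eq_succ_of_ne_zero hpos.ne'
  have h1 := aux_grid_le d n hd T hT hδT _ _ hz hst m (by omega)
  have h2 := aux_lt_M d T (Real.sqrt d * 2 ^ (-(n : ℤ))) hT f m (by omega)
  rw [Nat.succ_eq_add_one] at hm
  have h3 : 0 < 1 - Real.sqrt d * 2 ^ (-(n : ℤ)) / T := by
    rw [sub_pos, div_lt_one hT]; exact hδT
  have h4 := mul_lt_mul_of_pos_left h2 h3
  have h5 : (1 - Real.sqrt d * 2 ^ (-(n : ℤ)) / T) * T = T - Real.sqrt d * 2 ^ (-(n : ℤ)) := by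
    field_simp
  rw [← hm] at h1
  linarith

theorem GridFacts.mono {d n : ℕ} {T : ℝ} {τ : ℕ → ℝ} {M : ℕ} {σ : ℕ → ℝ}
    (F : GridFacts d n T τ M σ) {i j : ℕ} (hij : i ≤ j) (hj : j ≤ M) : σ i ≤ σ j := by
  induction j, hij using Nat.le_induction with
  | base => exact le_rfl
  | succ j hij ih => exact (ih (by omega)).trans (F.lt j (by omega)).le

theorem aux_bracket (σ : ℕ → ℝ) (h0 : σ 0 = 0) (u : ℝ) (hu : 0 ≤ u) (K : ℕ) (hK : u < σ K) :
    ∃ j < K, σ j ≤ u ∧ u < σ (j+1) := by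
  induction K with
  | zero => linarith
  | succ K ih =>
    by_cases h : u < σ K
    · obtain ⟨j, h1, h2⟩ := ih h
      exact ⟨j, by omega, h2⟩
    · exact ⟨K, by omega, not_lt.1 h, hK⟩

theorem aux_bracket2 (σ : ℕ → ℝ) (h0 : σ 0 = 0) (u : ℝ) (hu : 0 < u) (K : ℕ) (hK : u ≤ σ K) :
    ∃ j < K, σ j < u ∧ u ≤ σ (j+1) := by
  induction K with
  | zero => linarith
  | succ K ih =>
    by_cases h : u ≤ σ K
    · obtain ⟨j, h1, h2⟩ := ih h
      exact ⟨j, by omega, h2⟩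
    · exact ⟨K, by omega, not_le.1 h, hK⟩

theorem aux_val (d n : ℕ) (hd : 1 ≤ d) (T : ℝ) (hT : 0 < T)
    (hδT : Real.sqrt d * 2 ^ (-(n : ℤ)) < T) (f : ℝ → E d) (hf : IsCadlagOn d T f)
    (τ σ : ℕ → ℝ) (M : ℕ) (hτ : τ = exitTimes d T (Real.sqrt d * 2 ^ (-(n : ℤ))) f)
    (hM : M = exitCount d T (Real.sqrt d * 2 ^ (-(n : ℤ))) f)
    (hσ : σ = gridTimes d n T τ M) :
    GridFacts d n T τ M σ ∧
    (∀ j < M, ∀ u, σ j ≤ u → u < σ (j+1) → hatPi d n T f u = dyadicRound d (n+j) (f (τ j))) ∧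
    (∀ u, σ M ≤ u → u ≤ T → hatPi d n T f u = dyadicRound d n (f T)) := by
  have F := aux_facts d n hd T hT hδT f hf
  rw [← hM, ← hτ, ← hσ] at F
  refine ⟨F, fun j hj u h1 h2 => ?_, fun u h1 h2 => ?_⟩
  · simp only [hatPi]
    rw [← hM, ← hτ, ← hσ]
    have hm := F.mono (show j + 1 ≤ M by omega) le_rfl
    rw [Finset.sum_eq_single j, indicator_of_mem (show u ∈ Ico (σ j) (σ (j+1)) from ⟨h1, h2⟩), indicator_of_notMem,
      add_zero]
    · rintro ⟨h3, _⟩; linarith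
    · intro b hb hbj
      apply indicator_of_notMem
      rintro ⟨h3, h4⟩
      rw [Finset.mem_range] at hb
      rcases lt_or_gt_of_ne hbj with h | h
      · have := F.mono (show b + 1 ≤ j by omega) hj.le
        linarith
      · have := F.mono (show j + 1 ≤ b by omega) hb.le
        linarith
    · intro h; exact absurd (Finset.mem_range.2 hj) h
  · simp only [hatPi]
    rw [← hM, ← hτ, ← hσ]
    rw [Finset.sum_eq_zero, indicator_of_mem (show u ∈ Icc (σ M) T from ⟨h1, h2⟩), zero_add]
    intro b hb
    apply indicator_of_notMem
    rintro ⟨h3, h4⟩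
    rw [Finset.mem_range] at hb
    have := F.mono (show b + 1 ≤ M by omega) le_rfl
    linarith

theorem aux_round_pos (d m : ℕ) (x : E d) (hx : ∀ i, 0 < x i) (i : Fin d) :
    0 < dyadicRound d m x i := by
  have h1 : 0 < ⌈(2 : ℝ) ^ (m : ℤ) * x i⌉ := Int.ceil_pos.2 (mul_pos (by positivity) (hx i))
  have h2 : (0:ℝ) < (⌈(2 : ℝ) ^ (m : ℤ) * x i⌉ : ℤ) := by exact_mod_cast h1
  simp only [dyadicRound]
  positivity

theorem aux_round_one (d m : ℕ) (x : E d) (hx : ∀ i, x i = 1) (i : Fin d) :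
    dyadicRound d m x i = 1 := by
  have h1 : ⌈(2 : ℝ) ^ (m : ℤ) * x i⌉ = 2 ^ m := by
    rw [hx, mul_one, zpow_natCast]
    exact_mod_cast Int.ceil_intCast (R := ℝ) (2 ^ m)
  simp only [dyadicRound]
  rw [h1]
  simp

theorem aux_hatPi_mem (d n : ℕ) (hd : 1 ≤ d) (T : ℝ) (hT : 0 < T)
    (hδT : Real.sqrt d * 2 ^ (-(n : ℤ)) < T) (f : ℝ → E d) (hf : f ∈ DPos d T) :
    hatPi d n T f ∈ DPos d T := by
  obtain ⟨hc, -, hf0, hpos⟩ := hf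
  obtain ⟨F, hv, hvT⟩ := aux_val d n hd T hT hδT f hc _ _ _ rfl rfl rfl
  set τ := exitTimes d T (Real.sqrt d * 2 ^ (-(n : ℤ))) f
  set M := exitCount d T (Real.sqrt d * 2 ^ (-(n : ℤ))) f
  set σ := gridTimes d n T τ M
  have hτ0 : ∀ k, 0 ≤ τ k := fun k => F.tau_zero ▸ F.tau_mono (Nat.zero_le k)
  have hσ0 : ∀ k ≤ M, 0 ≤ σ k := fun k hk => F.zero ▸ F.mono (Nat.zero_le k) hk
  have hleft : ∀ (a u : ℝ) (c : E d), 0 ≤ a → a < u →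
      (∀ s, a ≤ s → s < u → hatPi d n T f s = c) →
      Tendsto (hatPi d n T f) (nhdsWithin u (Ico 0 u)) (nhds c) := by
    intro a u c ha hau H
    apply tendsto_const_nhds.congr'
    have h1 : ∀ᶠ s in nhdsWithin u (Ico 0 u), a < s :=
      mem_nhdsWithin_of_mem_nhds (Ioi_mem_nhds hau)
    filter_upwards [h1, self_mem_nhdsWithin] with s hs1 hs2
    exact (H s hs1.le hs2.2).symm
  have hright : ∀ (b u : ℝ), u < b →
      (∀ s, u ≤ s → s < b → hatPi d n T f s = hatPi d n T f u) →
      Tendsto (hatPi d n T f) (nhdsWithin u (Ioo u T)) (nhds (hatPi d n T f u)) := by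
    intro b u hub H
    apply tendsto_const_nhds.congr'
    have h1 : ∀ᶠ s in nhdsWithin u (Ioo u T), s < b :=
      mem_nhdsWithin_of_mem_nhds (Iio_mem_nhds hub)
    filter_upwards [h1, self_mem_nhdsWithin] with s hs1 hs2
    exact (H s hs2.1.le hs1).symm
  refine ⟨⟨fun u hu => ?_, fun u hu => ?_⟩, ?_, ?_, ?_⟩
  · by_cases h : u < σ M
    · obtain ⟨j, hj, h1, h2⟩ := aux_bracket σ F.zero u hu.1 M h
      exact hright _ u h2 fun s hs1 hs2 => by
        rw [hv j hj s (h1.trans hs1) hs2, hv j hj u h1 h2]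
    · have h := not_lt.1 h
      exact hright _ u hu.2 fun s hs1 hs2 => by
        rw [hvT s (h.trans hs1) hs2.le, hvT u h hu.2.le]
  · by_cases h : u ≤ σ M
    · obtain ⟨j, hj, h1, h2⟩ := aux_bracket2 σ F.zero u hu.1 M h
      exact ⟨_, hleft (σ j) u _ (hσ0 j hj.le) h1 fun s hs1 hs2 =>
        hv j hj s hs1 (hs2.trans_le h2)⟩
    · have h := not_le.1 h
      exact ⟨_, hleft (σ M) u _ (hσ0 M le_rfl) h fun s hs1 hs2 => hvT s hs1 (hs2.le.trans hu.2)⟩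
  · refine hleft (σ M) T _ (hσ0 M le_rfl) F.lt_T fun s hs1 hs2 => ?_
    rw [hvT s hs1 hs2.le, hvT T F.lt_T.le le_rfl]
  · intro i
    have h1 := F.lt 0 F.pos
    rw [F.zero] at h1
    rw [hv 0 F.pos 0 F.zero.le h1, F.tau_zero]
    exact aux_round_one d _ _ hf0 i
  · intro u hu i
    by_cases h : u < σ M
    · obtain ⟨j, hj, h1, h2⟩ := aux_bracket σ F.zero u hu.1 M h
      rw [hv j hj u h1 h2]
      exact aux_round_pos d _ _ (hpos _ ⟨hτ0 j, (F.tau_lt j hj).le⟩) i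
    · rw [hvT u (not_lt.1 h) hu.2]
      exact aux_round_pos d _ _ (hpos _ ⟨hT.le, le_rfl⟩) i

theorem aux_gamma (d n : ℕ) (T : ℝ) (γh : ℝ → (ℝ → E d) → E d) (f : ℝ → E d) (t : ℝ)
    (τ σ : ℕ → ℝ) (M : ℕ) (hτ : τ = exitTimes d T (Real.sqrt d * 2 ^ (-(n : ℤ))) f)
    (hM : M = exitCount d T (Real.sqrt d * 2 ^ (-(n : ℤ))) f)
    (hσ : σ = gridTimes d n T τ M) (hmono : Monotone τ) (K : ℕ) (hK : K < M)
    (h1 : τ K < t) (h2 : t ≤ τ (K+1)) :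
    liftedGamma d n T γh f t = γh (σ (K+1)) (hatPi d n T f) := by
  simp only [liftedGamma]
  rw [← hM, ← hτ, ← hσ, Finset.sum_eq_single K,
    indicator_of_mem (show t ∈ Ioc (τ K) (τ (K+1)) from ⟨h1, h2⟩)]
  · intro b _ hbj
    apply indicator_of_notMem
    rintro ⟨h3, h4⟩
    rcases lt_or_gt_of_ne hbj with h | h
    · have := hmono (show b + 1 ≤ K by omega)
      linarith
    · have := hmono (show K + 1 ≤ b by omega)
      linarith
  · intro h; exact absurd (Finset.mem_range.2 hK) h

theorem aux_gamma_zero (d n : ℕ) (hd : 1 ≤ d) (T : ℝ) (hT : 0 < T)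
    (γh : ℝ → (ℝ → E d) → E d) (f : ℝ → E d) :
    liftedGamma d n T γh f 0 = 0 := by
  have hdp : (0:ℝ) < Real.sqrt d * 2 ^ (-(n : ℤ)) := by
    have : (0:ℝ) < d := by exact_mod_cast hd
    positivity
  simp only [liftedGamma]
  apply Finset.sum_eq_zero
  intro k _
  apply indicator_of_notMem
  rintro ⟨h3, _⟩
  have := aux_nonneg d T _ hT hdp f k
  linarith

/-- if `γ̂` is a predictable functional (it only depends on the path
strictly before time `t`), then the lifted strategy `γ` is progressively measurable in the
pathwise sense: `γ_t(S)` depends only on the restriction of `S` to `[0,t]`. -/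
theorem statement7 (d n : ℕ) (hd : 1 ≤ d) (T : ℝ) (hT : 0 < T)
    (hδT : Real.sqrt d * 2 ^ (-(n : ℤ)) < T)
    (γh : ℝ → (ℝ → E d) → E d)
    (hpred : ∀ t ∈ Set.Icc (0:ℝ) T, ∀ S ∈ DPos d T, ∀ S' ∈ DPos d T,
      (∀ u, 0 ≤ u → u < t → S u = S' u) → γh t S = γh t S') :
    ∀ t ∈ Set.Icc (0:ℝ) T, ∀ S ∈ DPos d T, ∀ S' ∈ DPos d T,
      (∀ u ∈ Set.Icc (0:ℝ) t, S u = S' u) →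
      liftedGamma d n T γh S t = liftedGamma d n T γh S' t := by
  intro t ht S hS S' hS' hSS
  rcases ht.1.eq_or_lt with h0 | h0
  · rw [← h0, aux_gamma_zero d n hd T hT, aux_gamma_zero d n hd T hT]
  have hdp : (0:ℝ) < Real.sqrt d * 2 ^ (-(n : ℤ)) := by
    have : (0:ℝ) < d := by exact_mod_cast hd
    positivity
  have hag := aux_agree d T _ hT hdp S S' t hSS
  obtain ⟨F, hv, -⟩ := aux_val d n hd T hT hδT S hS.1 _ _ _ rfl rfl rfl
  obtain ⟨F', hv', -⟩ := aux_val d n hd T hT hδT S' hS'.1 _ _ _ rfl rfl rfl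
  obtain ⟨K, hK, h1, h2⟩ := aux_bracket2 _ F.tau_zero t h0 _ (F.tau_M.symm ▸ ht.2)
  have hg := aux_gamma d n T γh S t _ _ _ rfl rfl rfl F.tau_mono K hK h1 h2
  have hτ : ∀ k ≤ K, exitTimes d T (Real.sqrt d * 2 ^ (-(n : ℤ))) S k =
      exitTimes d T (Real.sqrt d * 2 ^ (-(n : ℤ))) S' k := by
    intro k hk
    refine (hag k).resolve_right fun h => ?_
    have := F.tau_mono hk
    linarith [h.1]
  have h1' := h1
  rw [hτ K le_rfl] at h1'
  have h2' : t ≤ exitTimes d T (Real.sqrt d * 2 ^ (-(n : ℤ))) S' (K+1) := by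
    rcases hag (K+1) with h | h
    · rwa [← h]
    · exact h.2
  have hK' : K < exitCount d T (Real.sqrt d * 2 ^ (-(n : ℤ))) S' := by
    by_contra h
    have h3 := F'.tau_mono (not_lt.1 h)
    rw [F'.tau_M] at h3
    linarith [ht.2]
  have hg' := aux_gamma d n T γh S' t _ _ _ rfl rfl rfl F'.tau_mono K hK' h1' h2'
  have hσ := aux_grid_congr d n T _ _ _ _ K hK hK' hτ
  rw [hg, hg', ← hσ (K+1) le_rfl]
  refine hpred _ ⟨?_, ?_⟩ _ (aux_hatPi_mem d n hd T hT hδT S hS) _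
    (aux_hatPi_mem d n hd T hT hδT S' hS') fun u hu0 hu => ?_
  · have := F.mono (Nat.zero_le (K+1)) hK
    rwa [F.zero] at this
  · exact (F.mono (show K + 1 ≤ _ from hK) le_rfl).trans F.lt_T.le
  · obtain ⟨j, hj, h3, h4⟩ := aux_bracket _ F.zero u hu0 (K+1) hu
    rw [hv j (by omega) u h3 h4]
    rw [hσ j (by omega)] at h3
    rw [hσ (j+1) (by omega)] at h4
    rw [hv' j (by omega) u h3 h4, ← hτ j (by omega)]
    have h5 := F.tau_mono (show j ≤ K by omega)
    have h6 := F.tau_mono (Nat.zero_le j)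
    rw [F.tau_zero] at h6
    rw [hSS _ ⟨h6, by linarith⟩]

end
end
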